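/- arXiv:1907.06608 — 2 statements merged into one kernel-verified Lean document; each statement's English description precedes it below -/
import Mathlib

section
/- Let F be a field. The local ring F[[X, Y, Z, X₁, X₂]]/(X₁·X₂, X₁·Y, X₂·Y) has Krull dimension 3. -/
open MvPowerSeries

theorem aux_mem_span {σ F : Type*} [CommRing F] [DecidableEq σ] (S : Finset σ) :
    ∀ f : MvPowerSeries σ F, (∀ m : σ →₀ ℕ, (∀ i ∈ S, m i = 0) → coeff m f = 0) →
      f ∈ Ideal.span ((fun i => (X i : MvPowerSeries σ F)) '' (S : Set σ)) := by
  induction S using Finset.induction_on with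
  | empty =>
    intro f hf
    have : f = 0 := by
      ext m
      simpa using hf m (by simp)
    simp [this]
  | insert a S ha ih =>
    intro f hf
    let g : MvPowerSeries σ F := fun m => if m a = 0 then coeff m f else 0
    have hg : ∀ m, coeff m g = if m a = 0 then coeff m f else 0 := fun m => rfl
    have h1 : (X a : MvPowerSeries σ F) ∣ f - g := by
      rw [X_dvd_iff]
      intro m hm
      rw [map_sub, hg, if_pos hm, sub_self]
    have h2 : g ∈ Ideal.span ((fun i => (X i : MvPowerSeries σ F)) '' (S : Set σ)) := by
      apply ih
      intro m hm
      rw [hg]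
      split_ifs with h
      · apply hf
        intro i hi
        rcases Finset.mem_insert.mp hi with rfl | hi
        · exact h
        · exact hm i hi
      · rfl
    have h3 : f = (f - g) + g := by ring
    rw [h3]
    refine Ideal.add_mem _ ?_ ?_
    · refine Ideal.mem_of_dvd _ h1 (Ideal.subset_span ⟨a, by simp, rfl⟩)
    · refine Ideal.span_mono (Set.image_mono ?_) h2
      simp

theorem aux_mem_of_X_mem {F : Type*} [Field F] {n : ℕ} (P : Ideal (MvPowerSeries (Fin n) F))
    (hP : ∀ i, (X i : MvPowerSeries (Fin n) F) ∈ P) (f : MvPowerSeries (Fin n) F)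
    (hf : ¬ IsUnit f) : f ∈ P := by
  have h := aux_mem_span (F := F) (Finset.univ : Finset (Fin n)) f (by
    intro m hm
    have : m = 0 := by
      ext i
      simpa using hm i (by simp)
    subst this
    rw [coeff_zero_eq_constantCoeff_apply]
    by_contra h
    exact hf (isUnit_iff_constantCoeff.mpr (isUnit_iff_ne_zero.mpr h)))
  refine Ideal.span_le.mpr ?_ h
  rintro _ ⟨i, -, rfl⟩
  exact hP i

theorem aux_lower (F : Type*) [Field F] (n : ℕ) :
    (n : WithBot ℕ∞) ≤ ringKrullDim (MvPowerSeries (Fin n) F) := by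
  induction n with
  | zero => simpa using ringKrullDim_nonneg_of_nontrivial
  | succ n ih =>
    rw [ringKrullDim_eq_of_ringEquiv (finSuccEquiv F n).toRingEquiv]
    refine le_trans ?_ ringKrullDim_succ_le_ringKrullDim_powerseries
    push_cast
    gcongr

/-- The local ring `F[[X, Y, Z, X₁, X₂]]/(X₁X₂, X₁Y, X₂Y)` has Krull dimension 3. -/
theorem ringKrullDim_quotient_eq_three
    (F : Type*) [Field F] :
    let Y : MvPowerSeries (Fin 5) F := X 1
    let X₁ : MvPowerSeries (Fin 5) F := X 3
    let X₂ : MvPowerSeries (Fin 5) F := X 4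
    ringKrullDim
      (MvPowerSeries (Fin 5) F ⧸ Ideal.span {X₁ * X₂, X₁ * Y, X₂ * Y}) = 3 := by
  intro Y X₁ X₂
  set I : Ideal (MvPowerSeries (Fin 5) F) := Ideal.span {X₁ * X₂, X₁ * Y, X₂ * Y} with hI
  let e : Fin 3 ↪ Fin 5 := ⟨![0, 2, 3], by decide⟩
  let φ : MvPowerSeries (Fin 5) F →+* MvPowerSeries (Fin 3) F := (killCompl (R := F) e).toRingHom
  have hφ : Function.Surjective φ := fun p => ⟨rename e p, killCompl_rename_app p⟩
  have hY : φ Y = 0 := killCompl_X_eq_zero (by simp only [Set.mem_range, e]; decide)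
  have hX₂ : φ X₂ = 0 := killCompl_X_eq_zero (by simp only [Set.mem_range, e]; decide)
  have hIφ : ∀ a ∈ I, φ a = 0 := by
    have : I ≤ RingHom.ker φ := by
      rw [hI, Ideal.span_le]
      rintro _ (rfl | rfl | rfl) <;> simp [RingHom.mem_ker, hY, hX₂]
    exact fun a ha => this ha
  let ψ := Ideal.Quotient.lift I φ hIφ
  have hψ : Function.Surjective ψ := Ideal.Quotient.lift_surjective_of_surjective _ _ hφ
  have : Nontrivial (MvPowerSeries (Fin 5) F ⧸ I) := hψ.nontrivial
  have : IsLocalRing (MvPowerSeries (Fin 5) F ⧸ I) :=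
    IsLocalRing.of_surjective' (Ideal.Quotient.mk I) Ideal.Quotient.mk_surjective
  apply le_antisymm
  · rw [← IsLocalRing.maximalIdeal_height_eq_ringKrullDim]
    classical
    let q := Ideal.Quotient.mk I
    let s : Finset (MvPowerSeries (Fin 5) F ⧸ I) := {q (X 0), q (X 2), q (X₁ + X₂ + Y)}
    have hmem : ∀ f, constantCoeff f = 0 → q f ∈ IsLocalRing.maximalIdeal _ := by
      intro f hf
      rw [IsLocalRing.mem_maximalIdeal, mem_nonunits_iff]
      intro hu
      have h1 := hu.map ψ
      have h2 : ψ (q f) = φ f := rfl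
      rw [h2, isUnit_iff_constantCoeff] at h1
      have h3 : constantCoeff (φ f) = constantCoeff f := by
        rw [← coeff_zero_eq_constantCoeff_apply, ← coeff_zero_eq_constantCoeff_apply]
        change coeff 0 (killCompl e f) = _
        rw [coeff_killCompl]
        simp
      rw [h3, hf] at h1
      simp at h1
    have hs : IsLocalRing.maximalIdeal (MvPowerSeries (Fin 5) F ⧸ I) ∈
        (Ideal.span (s : Set (MvPowerSeries (Fin 5) F ⧸ I))).minimalPrimes := by
      refine ⟨⟨inferInstance, ?_⟩, ?_⟩
      · rw [Ideal.span_le]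
        intro x hx
        simp only [s, Finset.coe_insert, Finset.coe_singleton, Set.mem_insert_iff,
          Set.mem_singleton_iff] at hx
        rcases hx with rfl | rfl | rfl <;> apply hmem <;> simp [X₁, X₂, Y]
      · rintro P ⟨hP, hsP⟩ -
        have hx0 : q (X 0) ∈ P := hsP (Ideal.subset_span (by simp [s]))
        have hx2 : q (X 2) ∈ P := hsP (Ideal.subset_span (by simp [s]))
        have hx : q (X₁ + X₂ + Y) ∈ P := hsP (Ideal.subset_span (by simp [s]))
        have h12 : q X₁ * q X₂ = 0 := by
          rw [← map_mul]; exact Ideal.Quotient.eq_zero_iff_mem.mpr (Ideal.subset_span (by simp))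
        have h1Y : q X₁ * q Y = 0 := by
          rw [← map_mul]; exact Ideal.Quotient.eq_zero_iff_mem.mpr (Ideal.subset_span (by simp))
        have h2Y : q X₂ * q Y = 0 := by
          rw [← map_mul]; exact Ideal.Quotient.eq_zero_iff_mem.mpr (Ideal.subset_span (by simp))
        rw [map_add, map_add] at hx
        have k1 : q X₁ ∈ P := by
          refine hP.mem_of_pow_mem 2 ?_
          have := P.mul_mem_left (q X₁) hx
          rwa [show q X₁ * (q X₁ + q X₂ + q Y) = q X₁ ^ 2 by linear_combination h12 + h1Y] at this
        have k2 : q X₂ ∈ P := by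
          refine hP.mem_of_pow_mem 2 ?_
          have := P.mul_mem_left (q X₂) hx
          rwa [show q X₂ * (q X₁ + q X₂ + q Y) = q X₂ ^ 2 by linear_combination h12 + h2Y] at this
        have kY : q Y ∈ P := by
          refine hP.mem_of_pow_mem 2 ?_
          have := P.mul_mem_left (q Y) hx
          rwa [show q Y * (q X₁ + q X₂ + q Y) = q Y ^ 2 by linear_combination h1Y + h2Y] at this
        intro x hxm
        obtain ⟨f, rfl⟩ := Ideal.Quotient.mk_surjective x
        refine aux_mem_of_X_mem (P.comap q) ?_ f ?_
        · intro i
          fin_cases i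
          · exact hx0
          · exact kY
          · exact hx2
          · exact k1
          · exact k2
        · intro hu
          exact (IsLocalRing.mem_maximalIdeal _).mp hxm (hu.map q)
    have h := Ideal.height_le_card_of_mem_minimalPrimes_span_finset hs
    have hc : s.card ≤ 3 := Finset.card_le_three
    have h' := h.trans (Nat.cast_le.mpr hc)
    exact WithBot.coe_le_coe.mpr h'
  · exact le_trans (by simpa using aux_lower F 3) (ringKrullDim_le_of_surjective ψ hψ)
end

section
/- Let F be a field. The local ring R = F[[X, Y, Z, X₁, X₂]]/(X₁·X₂, X₁·Y, X₂·Y) is not a local complete intersection ring: it has embedding dimension 5 and Krull dimension 3, but its defining ideal cannot be generated by 2 elements. -/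
open MvPowerSeries

namespace QNCI

noncomputable abbrev A (F : Type*) [Field F] := MvPowerSeries (Fin 5) F

noncomputable abbrev I (F : Type*) [Field F] : Ideal (A F) :=
  Ideal.span {(X 3 : A F) * X 4, (X 3 : A F) * X 1, (X 4 : A F) * X 1}

noncomputable abbrev m (F : Type*) [Field F] : Ideal (A F) := IsLocalRing.maximalIdeal (A F)

variable {F : Type*} [Field F]

lemma mem_m {f : A F} : f ∈ m F ↔ constantCoeff f = 0 := by
  rw [IsLocalRing.mem_maximalIdeal, mem_nonunits_iff, isUnit_iff_constantCoeff, isUnit_iff_ne_zero,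
    not_not]

lemma mem_span_aux (s : Finset (Fin 5)) : ∀ f : A F,
    (∀ d : Fin 5 →₀ ℕ, (∀ i ∈ s, d i = 0) → coeff d f = 0) →
      f ∈ Ideal.span (Set.range (X : Fin 5 → A F)) := by
  induction s using Finset.induction_on with
  | empty =>
    intro f h
    have : f = 0 := by
      ext d
      simpa using h d (by simp)
    simp [this]
  | insert i s hi ih =>
    intro f h
    let g : A F := fun d => if d i = 0 then coeff d f else 0
    have hg : ∀ d, coeff d g = if d i = 0 then coeff d f else 0 := fun d => rfl
    have h1 : g ∈ Ideal.span (Set.range (X : Fin 5 → A F)) := by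
      apply ih
      intro d hd
      rw [hg]
      split_ifs with h0
      · apply h
        intro j hj
        rcases Finset.mem_insert.1 hj with rfl | hj
        · exact h0
        · exact hd j hj
      · rfl
    have h2 : (X i : A F) ∣ f - g := by
      rw [X_dvd_iff]
      intro d hd
      rw [map_sub, hg, if_pos hd, sub_self]
    obtain ⟨k, hk⟩ := h2
    have : f = k * X i + g := by rw [mul_comm, ← hk]; ring
    rw [this]
    exact Ideal.add_mem _ (Ideal.mul_mem_left _ _ (Ideal.subset_span ⟨i, rfl⟩)) h1

lemma m_eq : m F = Ideal.span (Set.range (X : Fin 5 → A F)) := by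
  apply le_antisymm
  · intro f hf
    rw [mem_m] at hf
    apply mem_span_aux Finset.univ
    intro d hd
    have : d = 0 := by
      ext i
      exact hd i (Finset.mem_univ _)
    rw [this]
    simpa using hf
  · rw [Ideal.span_le]
    rintro _ ⟨i, rfl⟩
    exact mem_m.2 (constantCoeff_X i)

lemma X_mem (i : Fin 5) : (X i : A F) ∈ m F := mem_m.2 (constantCoeff_X i)

lemma I_le : I F ≤ (m F) ^ 2 := by
  rw [Ideal.span_le, pow_two]
  rintro x (rfl | rfl | rfl) <;> exact Ideal.mul_mem_mul (X_mem _) (X_mem _)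

lemma I_le_m : I F ≤ m F := I_le.trans (Ideal.pow_le_self two_ne_zero)

lemma coeff_sq {f : A F} (hf : f ∈ (m F) ^ 2) (i : Fin 5) :
    coeff (Finsupp.single i 1) f = 0 := by
  rw [pow_two] at hf
  refine Submodule.mul_induction_on hf ?_ ?_
  · intro a ha b hb
    apply coeff_of_lt_order
    have h1 := one_le_order_iff_constCoeff_eq_zero.2 (mem_m.1 ha)
    have h2 := one_le_order_iff_constCoeff_eq_zero.2 (mem_m.1 hb)
    refine lt_of_lt_of_le ?_ ((add_le_add h1 h2).trans le_order_mul)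
    rw [Finsupp.degree_single]
    norm_num
  · intro a b ha hb
    rw [map_add, ha, hb, add_zero]

noncomputable abbrev J (F : Type*) [Field F] : Ideal (A F ⧸ I F) := Ideal.map (Ideal.Quotient.mk (I F)) (m F)

noncomputable def psi (F : Type*) [Field F] : (Fin 5 → F) →ₗ[F] (J F).Cotangent :=
  Fintype.linearCombination F (fun i => (J F).toCotangent
    ⟨Ideal.Quotient.mk (I F) (X i), Ideal.mem_map_of_mem _ (X_mem i)⟩)

lemma lin_mem (c : Fin 5 → F) : (∑ i, C (c i) * X i : A F) ∈ m F :=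
  Ideal.sum_mem _ fun i _ => Ideal.mul_mem_left _ _ (X_mem i)

lemma psi_apply (c : Fin 5 → F) : psi F c = (J F).toCotangent
    ⟨Ideal.Quotient.mk (I F) (∑ i, C (c i) * X i), Ideal.mem_map_of_mem _ (lin_mem c)⟩ := by
  have : (⟨Ideal.Quotient.mk (I F) (∑ i, C (c i) * X i), Ideal.mem_map_of_mem _ (lin_mem c)⟩ : J F)
      = ∑ i, (Ideal.Quotient.mk (I F) (C (c i))) •
        (⟨Ideal.Quotient.mk (I F) (X i), Ideal.mem_map_of_mem _ (X_mem i)⟩ : J F) := by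
    apply Subtype.ext
    simp
  rw [this, map_sum, psi, Fintype.linearCombination_apply]
  refine Finset.sum_congr rfl fun i _ => ?_
  rw [map_smul]
  exact (algebraMap_smul (A F ⧸ I F) (c i) ((J F).toCotangent
    ⟨Ideal.Quotient.mk (I F) (X i), Ideal.mem_map_of_mem _ (X_mem i)⟩)).symm

lemma finrank_eq : Module.finrank F (J F).Cotangent = 5 := by
  have hb : Function.Bijective (psi F) := by
    constructor
    · rw [injective_iff_map_eq_zero]
      intro c hc
      rw [psi_apply, Ideal.toCotangent_eq_zero, ← Ideal.map_pow,
        Ideal.mem_map_iff_of_surjective _ Ideal.Quotient.mk_surjective] at hc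
      obtain ⟨g, hg, hgc⟩ := hc
      have h1 := I_le (Ideal.Quotient.eq.1 hgc)
      have h2 := Ideal.sub_mem _ hg h1
      rw [sub_sub_cancel] at h2
      funext j
      have := coeff_sq h2 j
      rw [map_sum] at this
      simpa [coeff_C_mul, coeff_index_single_X] using this
    · intro y
      obtain ⟨⟨x, hx⟩, rfl⟩ := Ideal.toCotangent_surjective _ y
      obtain ⟨f, hf, rfl⟩ := (Ideal.mem_map_iff_of_surjective _ Ideal.Quotient.mk_surjective).1 hx
      have hf' := hf
      rw [m_eq] at hf'
      obtain ⟨g, rfl⟩ := (Submodule.mem_span_range_iff_exists_fun _).1 hf'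
      refine ⟨fun i => constantCoeff (g i), ?_⟩
      rw [psi_apply, Ideal.toCotangent_eq, ← map_sub, ← Ideal.map_pow]
      apply Ideal.mem_map_of_mem
      rw [← Finset.sum_sub_distrib]
      refine Ideal.sum_mem _ fun i _ => ?_
      rw [smul_eq_mul, ← sub_mul, pow_two]
      refine Ideal.mul_mem_mul ?_ (X_mem i)
      rw [mem_m]
      simp
  rw [← (LinearEquiv.ofBijective _ hb).finrank_eq]
  simp

lemma dim_fin (n : ℕ) : (n : WithBot ℕ∞) ≤ ringKrullDim (MvPowerSeries (Fin n) F) := by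
  induction n with
  | zero => exact_mod_cast ringKrullDim_nonneg_of_nontrivial
  | succ n ih =>
    rw [ringKrullDim_eq_of_ringEquiv (MvPowerSeries.finSuccEquiv F n).toRingEquiv]
    refine le_trans ?_ ringKrullDim_succ_le_ringKrullDim_powerseries
    push_cast
    gcongr

lemma dim_ge : 3 ≤ ringKrullDim (A F ⧸ I F) := by
  let e : Fin 3 ↪ Fin 5 := Fin.castLEEmb (by norm_num)
  have h3 : killCompl (R := F) e (X 3) = 0 := killCompl_X_eq_zero (by decide)
  have h4 : killCompl (R := F) e (X 4) = 0 := killCompl_X_eq_zero (by decide)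
  have hI : ∀ a ∈ I F, (killCompl (R := F) e).toRingHom a = 0 := by
    intro a ha
    have : I F ≤ RingHom.ker (killCompl (R := F) e).toRingHom := by
      rw [Ideal.span_le]
      rintro x (rfl | rfl | rfl) <;> simp [RingHom.mem_ker, h3, h4]
    exact this ha
  refine (dim_fin 3).trans (ringKrullDim_le_of_surjective
    (Ideal.Quotient.lift (I F) _ hI) (Ideal.Quotient.lift_surjective_of_surjective _ _ ?_))
  intro p
  exact ⟨rename e p, killCompl_rename_app p⟩

lemma dim_le : ringKrullDim (A F ⧸ I F) ≤ 3 := by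
  have hne : I F ≠ ⊤ := fun h => by
    have := I_le_m (F := F)
    rw [h, top_le_iff] at this
    exact (IsLocalRing.maximalIdeal.isMaximal (A F)).ne_top this
  have : Nontrivial (A F ⧸ I F) := Ideal.Quotient.nontrivial_iff.2 hne
  have : IsLocalRing (A F ⧸ I F) :=
    IsLocalRing.of_surjective' (Ideal.Quotient.mk (I F)) Ideal.Quotient.mk_surjective
  rw [← IsLocalRing.maximalIdeal_height_eq_ringKrullDim]
  let q := Ideal.Quotient.mk (I F)
  classical
  let s : Finset (A F ⧸ I F) := {q (X 0), q (X 2), q (X 1 + X 3 + X 4)}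
  have hcard : s.card ≤ 3 := Finset.card_le_three
  have hz : ∀ x ∈ I F, q x = 0 := fun x hx => Ideal.Quotient.eq_zero_iff_mem.2 hx
  have z1 : q (X 3) * q (X 4) = 0 := by
    rw [← map_mul]; exact hz _ (Ideal.subset_span (by simp))
  have z2 : q (X 3) * q (X 1) = 0 := by
    rw [← map_mul]; exact hz _ (Ideal.subset_span (by simp))
  have z3 : q (X 4) * q (X 1) = 0 := by
    rw [← map_mul]; exact hz _ (Ideal.subset_span (by simp))
  have hmin : IsLocalRing.maximalIdeal (A F ⧸ I F) ∈
      (Ideal.span (s : Set (A F ⧸ I F))).minimalPrimes := by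
    have hX : ∀ i, q (X i) ∈ IsLocalRing.maximalIdeal (A F ⧸ I F) := by
      intro i
      have h1 : (IsLocalRing.maximalIdeal (A F ⧸ I F)).comap q = m F := by
        have := Ideal.comap_isMaximal_of_surjective q Ideal.Quotient.mk_surjective
          (K := IsLocalRing.maximalIdeal (A F ⧸ I F))
        exact IsLocalRing.eq_maximalIdeal this
      rw [← Ideal.mem_comap, h1]
      exact X_mem i
    refine ⟨⟨inferInstance, ?_⟩, ?_⟩
    · rw [Ideal.span_le]
      intro x hx
      simp only [s, Finset.coe_insert, Finset.coe_singleton] at hx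
      rcases hx with rfl | rfl | rfl
      · exact hX _
      · exact hX _
      · rw [map_add, map_add]
        exact Ideal.add_mem _ (Ideal.add_mem _ (hX _) (hX _)) (hX _)
    · rintro p ⟨hp, hsp⟩ -
      have hs : ∀ x ∈ s, x ∈ p := fun x hx => hsp (Ideal.subset_span hx)
      have k0 : q (X 0) ∈ p := hs _ (by simp [s])
      have k2 : q (X 2) ∈ p := hs _ (by simp [s])
      have ks : q (X 1) + q (X 3) + q (X 4) ∈ p := by
        rw [← map_add, ← map_add]; exact hs _ (by simp [s])
      have sq : ∀ y, y ^ 2 = y * (q (X 1) + q (X 3) + q (X 4)) → y ∈ p := by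
        intro y hy
        apply hp.mem_of_pow_mem 2
        rw [hy]
        exact Ideal.mul_mem_left _ _ ks
      have k1 : q (X 1) ∈ p := sq _ (by linear_combination - z2 - z3)
      have k3 : q (X 3) ∈ p := sq _ (by linear_combination - z2 - z1)
      have k4 : q (X 4) ∈ p := sq _ (by linear_combination - z1 - z3)
      have hle : m F ≤ p.comap q := by
        rw [m_eq, Ideal.span_le]
        rintro _ ⟨i, rfl⟩
        fin_cases i <;> assumption
      intro y hy
      obtain ⟨x, rfl⟩ := Ideal.Quotient.mk_surjective y
      refine hle (?_ : x ∈ m F)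
      rw [IsLocalRing.mem_maximalIdeal, mem_nonunits_iff] at hy ⊢
      exact fun h => hy (h.map _)
  have := Ideal.height_le_card_of_mem_minimalPrimes_span_finset hmin
  have h3 := this.trans (Nat.cast_le.2 hcard)
  exact WithBot.coe_le_coe.2 h3

noncomputable def L (F : Type*) [Field F] : A F →ₗ[F] (Fin 3 → F) :=
  LinearMap.pi ![coeff (Finsupp.single 3 1 + Finsupp.single 4 1),
    coeff (Finsupp.single 3 1 + Finsupp.single 1 1),
    coeff (Finsupp.single 4 1 + Finsupp.single 1 1)]

lemma L_apply (u v w : A F) : L F (u * (X 3 * X 4) + v * (X 3 * X 1) + w * (X 4 * X 1)) =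
    ![constantCoeff u, constantCoeff v, constantCoeff w] := by
  have a1 : ¬ (Finsupp.single (3 : Fin 5) 1 + Finsupp.single 1 1 : Fin 5 →₀ ℕ) ≤ Finsupp.single 3 1 + Finsupp.single 4 1 :=
    fun h => by simpa [Finsupp.single_apply] using h 1
  have a2 : ¬ (Finsupp.single (4 : Fin 5) 1 + Finsupp.single 1 1 : Fin 5 →₀ ℕ) ≤ Finsupp.single 3 1 + Finsupp.single 4 1 :=
    fun h => by simpa [Finsupp.single_apply] using h 1
  have a3 : ¬ (Finsupp.single (3 : Fin 5) 1 + Finsupp.single 4 1 : Fin 5 →₀ ℕ) ≤ Finsupp.single 3 1 + Finsupp.single 1 1 :=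
    fun h => by simpa [Finsupp.single_apply] using h 4
  have a4 : ¬ (Finsupp.single (4 : Fin 5) 1 + Finsupp.single 1 1 : Fin 5 →₀ ℕ) ≤ Finsupp.single 3 1 + Finsupp.single 1 1 :=
    fun h => by simpa [Finsupp.single_apply] using h 4
  have a5 : ¬ (Finsupp.single (3 : Fin 5) 1 + Finsupp.single 4 1 : Fin 5 →₀ ℕ) ≤ Finsupp.single 4 1 + Finsupp.single 1 1 :=
    fun h => by simpa [Finsupp.single_apply] using h 3
  have a6 : ¬ (Finsupp.single (3 : Fin 5) 1 + Finsupp.single 1 1 : Fin 5 →₀ ℕ) ≤ Finsupp.single 4 1 + Finsupp.single 1 1 :=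
    fun h => by simpa [Finsupp.single_apply] using h 3
  funext i
  fin_cases i <;>
  simp [L, X_def, monomial_mul_monomial, coeff_mul_monomial, -Finsupp.single_add, a1, a2, a3, a4, a5, a6]

lemma mem_I {f : A F} (hf : f ∈ I F) : ∃ u v w : A F,
    f = u * (X 3 * X 4) + v * (X 3 * X 1) + w * (X 4 * X 1) := by
  obtain ⟨u, v, w, h⟩ := Submodule.mem_span_triple.1 hf
  exact ⟨u, v, w, h.symm⟩

lemma L_mul (r : A F) {f : A F} (hf : f ∈ I F) : L F (r * f) = constantCoeff r • L F f := by
  obtain ⟨u, v, w, rfl⟩ := mem_I hf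
  have : r * (u * (X 3 * X 4) + v * (X 3 * X 1) + w * (X 4 * X 1)) =
    (r * u) * (X 3 * X 4) + (r * v) * (X 3 * X 1) + (r * w) * (X 4 * X 1) := by ring
  rw [this, L_apply, L_apply]
  simp

lemma not_two : ¬ ∃ a b : A F, I F = Ideal.span {a, b} := by
  rintro ⟨a, b, h⟩
  have ha : a ∈ I F := h ▸ Ideal.subset_span (by simp)
  have hb : b ∈ I F := h ▸ Ideal.subset_span (by simp)
  let M : (Fin 2 → F) →ₗ[F] (Fin 3 → F) := Fintype.linearCombination F ![L F a, L F b]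
  have hM : Function.Surjective M := by
    intro c
    have hc : C (c 0) * (X 3 * X 4) + C (c 1) * (X 3 * X 1) + C (c 2) * (X 4 * X 1) ∈ I F :=
      Submodule.mem_span_triple.2 ⟨_, _, _, rfl⟩
    have hL := L_apply (C (c 0)) (C (c 1)) (C (c 2))
    rw [h] at hc
    obtain ⟨r, t, hrt⟩ := Ideal.mem_span_pair.1 hc
    rw [← hrt, map_add, L_mul r ha, L_mul t hb] at hL
    refine ⟨![constantCoeff r, constantCoeff t], ?_⟩
    have : M ![constantCoeff r, constantCoeff t] =
        constantCoeff r • L F a + constantCoeff t • L F b := by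
      simp [M, Fintype.linearCombination_apply, Fin.sum_univ_two]
    rw [this, hL]
    funext i
    fin_cases i <;> simp
  have := LinearMap.finrank_le_finrank_of_surjective hM
  simp at this

end QNCI


open MvPowerSeries

/-- `R = F[[X, Y, Z, X₁, X₂]]/(X₁X₂, X₁Y, X₂Y)` is not a local complete intersection:
it has embedding dimension 5 (the cotangent space of its maximal ideal, which is the image
of the maximal ideal of the power series ring, has `F`-dimension 5) and Krull dimension 3,
but the defining ideal cannot be generated by 2 elements. -/
theorem quotient_not_complete_intersection
    (F : Type*) [Field F] :
    let Y : MvPowerSeries (Fin 5) F := X 1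
    let X₁ : MvPowerSeries (Fin 5) F := X 3
    let X₂ : MvPowerSeries (Fin 5) F := X 4
    let I : Ideal (MvPowerSeries (Fin 5) F) := Ideal.span {X₁ * X₂, X₁ * Y, X₂ * Y}
    Module.finrank F
        (Ideal.map (Ideal.Quotient.mk I)
          (IsLocalRing.maximalIdeal (MvPowerSeries (Fin 5) F))).Cotangent = 5 ∧
      ringKrullDim (MvPowerSeries (Fin 5) F ⧸ I) = 3 ∧
      ¬ ∃ a b : MvPowerSeries (Fin 5) F, I = Ideal.span {a, b} := by
  intro Y X₁ X₂ I
  exact ⟨QNCI.finrank_eq, le_antisymm QNCI.dim_le QNCI.dim_ge, QNCI.not_two⟩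
end
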